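/- Let (X,d) be a complete separable metric space in which closed balls are compact, let α be a Young function satisfying the Δ₂-condition, and let p_α = sup_{x>0} x·α'₊(x)/α(x). For every n ∈ ℕ*, every bounded continuous function g : X^n → ℝ, every x ∈ X^n, every t ∈ [0,1), and every y^x ∈ X^n such that P_{α,n}g(x) = g(y^x) − Σ_{i=1}^n α(d(x_i,y^x_i)), it holds Σ_{i=1}^n ( t·P_{α,n}g(x) − Q_α^{(i)}( t·P_{α,n}g )(x) ) ≤ t·ε(t)·Σ_{i=1}^n α(d(x_i,y^x_i)), where ε(t) = (1 − t^{1/(p_α−1)})^{−(p_α−1)} − 1, P_{α,n} g(x) = sup_{y∈X^n} { g(y) − Σ_{i=1}^n α(d(x_i,y_i)) }, and Q_α^{(i)} h(x) = inf_{y∈X} { h(x₁,…,x_{i−1},y,x_{i+1},…,x_n) + α(d(x_i,y)) }. -/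

import Mathlib

open MeasureTheory Filter Set Topology
open scoped ENNReal NNReal

noncomputable section

/-- The right derivative of a function `α : ℝ → ℝ`. -/
def rightD (α : ℝ → ℝ) (x : ℝ) : ℝ := derivWithin α (Set.Ioi x) x

/-- The left derivative of a function `α : ℝ → ℝ`. -/
def leftD (α : ℝ → ℝ) (x : ℝ) : ℝ := derivWithin α (Set.Iio x) x

/-- A Young function: an even, convex, nonnegative function, increasing on `[0,∞)`,
vanishing at `0` and with vanishing right derivative at `0`. -/
structure IsYoung (α : ℝ → ℝ) : Prop where
  nonneg : ∀ x, 0 ≤ α x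
  even : ∀ x, α (-x) = α x
  convex : ConvexOn ℝ Set.univ α
  mono : StrictMonoOn α (Set.Ici 0)
  zero : α 0 = 0
  rightD_zero : rightD α 0 = 0

/-- The Δ₂-condition for a Young function. -/
def DeltaTwo (α : ℝ → ℝ) : Prop := ∃ K > 0, ∀ x : ℝ, α (2 * x) ≤ K * α x

/-- `r_α = inf_{x>0} x α'₋(x)/α(x)`. -/
def rAlpha (α : ℝ → ℝ) : ℝ := sInf {r : ℝ | ∃ x > 0, r = x * leftD α x / α x}

/-- `p_α = sup_{x>0} x α'₊(x)/α(x)`. -/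
def pAlpha (α : ℝ → ℝ) : ℝ := sSup {r : ℝ | ∃ x > 0, r = x * rightD α x / α x}

/-- The Fenchel-Legendre transform `α*(y) = sup_x {xy - α(x)}`, with values in `[0,∞]`. -/
def legendre (α : ℝ → ℝ) (y : ℝ) : ℝ≥0∞ := ⨆ x : ℝ, ENNReal.ofReal (x * y - α x)

/-- `ξ_α(t) = sup_{u>0} α*(t α'₊(u)) / (t α(u))`. -/
def xiAlpha (α : ℝ → ℝ) (t : ℝ) : ℝ≥0∞ :=
  ⨆ u : {u : ℝ // 0 < u}, legendre α (t * rightD α u) / ENNReal.ofReal (t * α u)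

/-- A bounded real-valued function. -/
def IsBoundedFun {Y : Type*} (f : Y → ℝ) : Prop := ∃ M, ∀ x, |f x| ≤ M

variable {X : Type*} [MetricSpace X] [MeasurableSpace X]

/-- The optimal transport cost `T_α(ν,μ)` between two measures, for the cost
function `(x,y) ↦ α(d(x,y))`. -/
def transportCost (α : ℝ → ℝ) (ν μ : Measure X) : ℝ≥0∞ :=
  sInf { c : ℝ≥0∞ | ∃ π : Measure (X × X), π.map Prod.fst = ν ∧ π.map Prod.snd = μ ∧
      c = ∫⁻ z, ENNReal.ofReal (α (dist z.1 z.2)) ∂π }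

open Classical in
/-- The relative entropy `H(ν|μ) = ∫ log (dν/dμ) dν` if `ν ≪ μ` (and `+∞` if `ν` is not
absolutely continuous with respect to `μ`, or if the integral diverges). -/
def relEnt (ν μ : Measure X) : ℝ≥0∞ :=
  if ν ≪ μ ∧ Integrable (fun x => Real.log (ν.rnDeriv μ x).toReal) ν
  then ENNReal.ofReal (∫ x, Real.log (ν.rnDeriv μ x).toReal ∂ν) else ⊤

/-- The transport-entropy inequality `T_α(C)`: for every probability measure `ν`,
`T_α(ν,μ) ≤ C H(ν|μ)`. -/
def TransportEntropy (μ : Measure X) (α : ℝ → ℝ) (C : ℝ) : Prop :=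
  ∀ ν : Measure X, IsProbabilityMeasure ν →
    transportCost α ν μ ≤ ENNReal.ofReal C * relEnt ν μ

/-- The entropy functional `Ent_μ(e^f)`. -/
def entExp (μ : Measure X) (f : X → ℝ) : ℝ :=
  ∫ x, Real.exp (f x) * Real.log (Real.exp (f x)) ∂μ
    - (∫ x, Real.exp (f x) ∂μ) * Real.log (∫ x, Real.exp (f x) ∂μ)

/-- `|∇⁺ f|(x) = limsup_{y → x} [f(y) - f(x)]₊ / d(y,x)` (equal to `0` at isolated
points by the conventions on `limsup` and `sInf` in `ℝ`). -/
def gradPlus (f : X → ℝ) (x : X) : ℝ :=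
  limsup (fun y => max (f y - f x) 0 / dist y x) (𝓝[≠] x)

/-- `|∇⁻ f|(x) = limsup_{y → x} [f(y) - f(x)]₋ / d(y,x)` (equal to `0` at isolated
points by the conventions on `limsup` and `sInf` in `ℝ`). -/
def gradMinus (f : X → ℝ) (x : X) : ℝ :=
  limsup (fun y => max (-(f y - f x)) 0 / dist y x) (𝓝[≠] x)

/-- The modified log-Sobolev inequality plus `LSI⁺_α(A)`. -/
def LSIplus (μ : Measure X) (α : ℝ → ℝ) (A : ℝ) : Prop :=
  ∀ f : X → ℝ, IsBoundedFun f → LocallyLipschitz f →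
    ENNReal.ofReal (entExp μ f) ≤
      ENNReal.ofReal A * ∫⁻ x, legendre α (gradPlus f x) * ENNReal.ofReal (Real.exp (f x)) ∂μ

/-- The modified log-Sobolev inequality minus `LSI⁻_α(A)`. -/
def LSIminus (μ : Measure X) (α : ℝ → ℝ) (A : ℝ) : Prop :=
  ∀ f : X → ℝ, IsBoundedFun f → LocallyLipschitz f →
    ENNReal.ofReal (entExp μ f) ≤
      ENNReal.ofReal A * ∫⁻ x, legendre α (gradMinus f x) * ENNReal.ofReal (Real.exp (f x)) ∂μ

/-- The inf-convolution operator `Q_α^λ f(x) = inf_y {f(y) + λ α(d(x,y))}`. -/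
def QInf (α : ℝ → ℝ) (lam : ℝ) (f : X → ℝ) (x : X) : ℝ :=
  ⨅ y : X, (f y + lam * α (dist x y))

/-- The `(τ)`-log-Sobolev inequality `(τ)-LSI_α(λ, A)`. -/
def TauLSI (μ : Measure X) (α : ℝ → ℝ) (lam A : ℝ) : Prop :=
  ∀ f : X → ℝ, IsBoundedFun f → LocallyLipschitz f →
    entExp μ f ≤ A * ∫ x, (f x - QInf α lam f x) * Real.exp (f x) ∂μ

/-- The `n`-dimensional inf-convolution operator
`Q_{α,n} f(x) = inf_y {f(y) + Σᵢ α(d(xᵢ,yᵢ))}`. -/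
def QInfN (α : ℝ → ℝ) {n : ℕ} (f : (Fin n → X) → ℝ) (x : Fin n → X) : ℝ :=
  ⨅ y : Fin n → X, (f y + ∑ i, α (dist (x i) (y i)))

/-- The `n`-dimensional sup-convolution operator
`P_{α,n} f(x) = sup_y {f(y) - Σᵢ α(d(xᵢ,yᵢ))}`. -/
def PSupN (α : ℝ → ℝ) {n : ℕ} (f : (Fin n → X) → ℝ) (x : Fin n → X) : ℝ :=
  ⨆ y : Fin n → X, (f y - ∑ i, α (dist (x i) (y i)))

end


noncomputable section
/-- The inf-convolution with respect to the `i`-th coordinate: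
`Q_α⁽ⁱ⁾ h(x) = inf_y {h(x̄ⁱy) + α(d(xᵢ,y))}`. -/
def QInfI {X : Type*} [MetricSpace X] (α : ℝ → ℝ) {n : ℕ} (i : Fin n)
    (h : (Fin n → X) → ℝ) (x : Fin n → X) : ℝ :=
  ⨅ y : X, (h (Function.update x i y) + α (dist (x i) y))
end

namespace IsYoung

variable {α : ℝ → ℝ}

theorem pos (hα : IsYoung α) {x : ℝ} (hx : 0 < x) : 0 < α x := by
  simpa [hα.zero] using hα.mono self_mem_Ici hx.le hx

theorem hasDerivWithinAt_rightD (hα : IsYoung α) (x : ℝ) :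
    HasDerivWithinAt α (rightD α x) (Ioi x) x :=
  hα.convex.hasDerivWithinAt_rightDeriv_of_mem_interior (by simp)

theorem continuous (hα : IsYoung α) : Continuous α :=
  continuousOn_univ.mp (hα.convex.continuousOn isOpen_univ)

/-- Under the Δ₂-condition, the supremum defining `p_α` bounds `x α'₊(x) / α(x)`. -/
theorem mul_rightD_le_pAlpha_mul (hα : IsYoung α) (hΔ : DeltaTwo α) {x : ℝ} (hx : 0 < x) :
    x * rightD α x ≤ pAlpha α * α x := by
  rw [← div_le_iff₀ (hα.pos hx)]
  refine le_csSup ?_ ⟨x, hx, rfl⟩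
  obtain ⟨K, -, hK⟩ := hΔ
  refine ⟨K - 1, ?_⟩
  rintro _ ⟨z, hz, rfl⟩
  have hslope : rightD α z ≤ slope α z (2 * z) :=
    hα.convex.rightDeriv_le_slope_of_mem_interior (by simp) (mem_univ _) (by linarith)
  rw [slope_def_field, le_div_iff₀ (by linarith)] at hslope
  rw [div_le_iff₀ (hα.pos hz)]
  linarith [hK z]

/-- A bound on the logarithmic right derivative gives a power growth bound. -/
theorem le_rpow_mul (hα : IsYoung α) {p : ℝ}
    (hp : ∀ x, 0 < x → x * rightD α x ≤ p * α x) {a b : ℝ} (ha : 0 < a) (hab : a ≤ b) :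
    α b ≤ (b / a) ^ p * α a := by
  have hpos : ∀ x ∈ Icc a b, 0 < x := fun x hx => ha.trans_le hx.1
  have key : α b * b ^ (-p) ≤ α a * a ^ (-p) := by
    refine image_le_of_deriv_right_le_deriv_boundary (f := fun x => α x * x ^ (-p))
      (f' := fun x => rightD α x * x ^ (-p) + α x * (-p * x ^ (-p - 1)))
      (B := fun _ => α a * a ^ (-p)) (B' := fun _ => 0) ?_ ?_ le_rfl continuousOn_const
      (fun x _ => hasDerivWithinAt_const _ _ _) ?_ (right_mem_Icc.mpr hab)
    · exact hα.continuous.continuousOn.mul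
        (continuousOn_id.rpow_const fun x hx => Or.inl (hpos x hx).ne')
    · intro x hx
      exact (hα.hasDerivWithinAt_rightD x).Ici_of_Ioi.mul
        (Real.hasDerivAt_rpow_const (Or.inl (hpos x ⟨hx.1, hx.2.le⟩).ne')).hasDerivWithinAt
    · intro x hx
      have hx0 := hpos x ⟨hx.1, hx.2.le⟩
      have hsplit : x ^ (-p) = x ^ (-p - 1) * x := by
        rw [← Real.rpow_add_one hx0.ne', sub_add_cancel]
      have := mul_nonneg (Real.rpow_nonneg hx0.le (-p - 1)) (sub_nonneg.mpr (hp x hx0))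
      rw [hsplit]
      linarith
  have hb : 0 < b := ha.trans_le hab
  rw [Real.rpow_neg hb.le, Real.rpow_neg ha.le, ← div_eq_mul_inv, ← div_eq_mul_inv,
    div_le_iff₀ (by positivity)] at key
  rw [Real.div_rpow hb.le ha.le]
  exact key.trans_eq (by ring)

theorem one_lt_pAlpha (hα : IsYoung α) (hΔ : DeltaTwo α) : 1 < pAlpha α := by
  by_contra! h
  have hlin : ∀ x, 0 < x → x * rightD α x ≤ 1 * α x := fun x hx =>
    (hα.mul_rightD_le_pAlpha_mul hΔ hx).trans (mul_le_mul_of_nonneg_right h (hα.nonneg x))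
  have hder := hα.hasDerivWithinAt_rightD 0
  rw [hα.rightD_zero, hasDerivWithinAt_iff_tendsto_slope' self_notMem_Ioi] at hder
  refine (hα.pos one_pos).not_ge (ge_of_tendsto hder ?_)
  filter_upwards [Ioc_mem_nhdsGT one_pos] with a ha
  have := hα.le_rpow_mul hlin ha.1 ha.2
  simpa [slope_def_field, hα.zero, div_eq_inv_mul] using this

/-- Dilating by `1 / s` with `s ∈ (0, 1]` costs at most a factor `s ^ (-p_α)`, stated after multiplying by `s`. -/
theorem mul_apply_div_le (hα : IsYoung α) (hΔ : DeltaTwo α) {s u : ℝ} (hs : 0 < s) (hs1 : s ≤ 1)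
    (hu : 0 ≤ u) : s * α (u / s) ≤ s ^ (-(pAlpha α - 1)) * α u := by
  rcases hu.eq_or_lt with rfl | hu
  · simp [hα.zero]
  have h := hα.le_rpow_mul (fun x hx => hα.mul_rightD_le_pAlpha_mul hΔ hx) hu
    (le_div_self hu.le hs hs1)
  have hdiv : u / s / u = s⁻¹ := by field_simp
  rw [hdiv, Real.inv_rpow hs.le, ← Real.rpow_neg hs.le] at h
  have hexp : s ^ (-(pAlpha α - 1)) = s * s ^ (-pAlpha α) := by
    rw [mul_comm, ← Real.rpow_add_one hs.ne']
    ring_nf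
  rw [hexp, mul_assoc]
  exact mul_le_mul_of_nonneg_left h hs.le

theorem mul_apply_add_sub_le (hα : IsYoung α) (hΔ : DeltaTwo α) {t u v : ℝ} (ht0 : 0 ≤ t)
    (ht1 : t < 1) (hu : 0 ≤ u) (hv : 0 ≤ v) :
    t * (α (u + v) - α u) - α v ≤
      t * ((1 - t ^ (1 / (pAlpha α - 1))) ^ (-(pAlpha α - 1)) - 1) * α u := by
  rcases ht0.eq_or_lt with rfl | ht
  · simpa using hα.nonneg v
  have hp : 0 < pAlpha α - 1 := sub_pos.mpr (hα.one_lt_pAlpha hΔ)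
  set s := t ^ (1 / (pAlpha α - 1)) with hs
  have hs0 : 0 < s := Real.rpow_pos_of_pos ht _
  have hs1 : s < 1 := Real.rpow_lt_one ht0 ht1 (by positivity)
  have hts : t * s ^ (-(pAlpha α - 1)) = 1 := by
    rw [hs, ← Real.rpow_mul ht0, show 1 / (pAlpha α - 1) * -(pAlpha α - 1) = -1 by field_simp,
      Real.rpow_neg_one, mul_inv_cancel₀ ht.ne']
  have hs1' : 0 < 1 - s := sub_pos.mpr hs1
  have hconv := hα.convex.2 (mem_univ (u / (1 - s))) (mem_univ (v / s)) hs1'.le hs0.le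
    (sub_add_cancel 1 s)
  simp only [smul_eq_mul, mul_div_cancel₀ _ hs0.ne', mul_div_cancel₀ _ hs1'.ne'] at hconv
  have hle := mul_le_mul_of_nonneg_left (hconv.trans (add_le_add
    (hα.mul_apply_div_le hΔ hs1' (by linarith) hu) (hα.mul_apply_div_le hΔ hs0 hs1.le hv))) ht0
  have hv' : t * (s ^ (-(pAlpha α - 1)) * α v) = α v := by rw [← mul_assoc, hts, one_mul]
  rw [mul_add, hv'] at hle
  linarith

theorem le_PSupN {X : Type*} [MetricSpace X] (hα : IsYoung α) {n : ℕ} {g : (Fin n → X) → ℝ}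
    (hgb : IsBoundedFun g) (x y : Fin n → X) :
    g y - ∑ i, α (dist (x i) (y i)) ≤ PSupN α g x := by
  obtain ⟨M, hM⟩ := hgb
  refine le_ciSup (f := fun y : Fin n → X => g y - ∑ i, α (dist (x i) (y i))) ⟨M, ?_⟩ y
  rintro _ ⟨z, rfl⟩
  exact (sub_le_self _ (Finset.sum_nonneg fun i _ => hα.nonneg _)).trans
    ((le_abs_self _).trans (hM z))

end IsYoung

theorem sup_convolution_inf_convolution_bound
    {X : Type*} [MetricSpace X] [CompleteSpace X] [TopologicalSpace.SeparableSpace X]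
    [ProperSpace X]
    (α : ℝ → ℝ) (hα : IsYoung α) (hΔ : DeltaTwo α)
    (n : ℕ) (hn : 0 < n) (g : (Fin n → X) → ℝ) (hgc : Continuous g) (hgb : IsBoundedFun g)
    (x : Fin n → X) (t : ℝ) (ht0 : 0 ≤ t) (ht1 : t < 1)
    (y : Fin n → X) (hy : PSupN α g x = g y - ∑ i, α (dist (x i) (y i))) :
    ∑ i, (t * PSupN α g x - QInfI α i (fun z => t * PSupN α g z) x) ≤
      t * ((1 - t ^ (1 / (pAlpha α - 1))) ^ (-(pAlpha α - 1)) - 1) *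
        ∑ i, α (dist (x i) (y i)) := by
  rw [Finset.mul_sum]
  refine Finset.sum_le_sum fun i _ => ?_
  have : Nonempty X := ⟨x i⟩
  rw [sub_le_comm]
  refine le_ciInf fun z => ?_
  have hP := hα.le_PSupN hgb (Function.update x i z) y
  have hsum : ∑ j, α (dist (Function.update x i z j) (y j)) =
      ∑ j, α (dist (x j) (y j)) - α (dist (x i) (y i)) + α (dist z (y i)) := by
    rw [← Finset.add_sum_erase _ _ (Finset.mem_univ i),
      ← Finset.add_sum_erase Finset.univ (fun j => α (dist (x j) (y j))) (Finset.mem_univ i),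
      Function.update_self, Finset.sum_congr rfl fun j hj => by
        rw [Function.update_of_ne (Finset.ne_of_mem_erase hj)]]
    ring
  have hdist : α (dist z (y i)) ≤ α (dist (x i) (y i) + dist (x i) z) := by
    refine hα.mono.monotoneOn dist_nonneg (add_nonneg dist_nonneg dist_nonneg) ?_
    linarith [dist_triangle z (x i) (y i), dist_comm z (x i)]
  have hPx : PSupN α g x - PSupN α g (Function.update x i z) ≤
      α (dist (x i) (y i) + dist (x i) z) - α (dist (x i) (y i)) := by linarith
  have := mul_le_mul_of_nonneg_left hPx ht0
  have := hα.mul_apply_add_sub_le hΔ ht0 ht1 (dist_nonneg (x := x i) (y := y i))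
    (dist_nonneg (x := x i) (y := z))
  linarith
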